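/- Let A ∈ ℝ_max^{n×n} with λ(A) = 0, whose critical graph C(A) is strongly connected with a unique critical cycle Z_0 of length g = g(C(A)) up to choice of its first node. If T_1(A) = DM(g,n), then there exists a pair (i,j) with (A^{DM(g,n)−1})_{ij} < (CS^{DM(g,n)−1}R[A])_{ij}, and for every such pair (i,j) there exists an interesting walk from i to j. -/

import Mathlib

open scoped Classical

noncomputable section

/-- The max-plus semiring carrier: `ℝ ∪ {-∞}`. `max` is the semiring addition `⊕`
and `+` (with `⊥` absorbing) is the semiring multiplication `⊗`. -/
abbrev Rmax : Type := WithBot ℝ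

/-- Square max-plus matrices. -/
abbrev Mat (n : ℕ) : Type := Fin n → Fin n → Rmax

namespace MaxPlus

variable {n : ℕ}

/-- Entrywise max-plus sum of matrices. -/
def oplus (A B : Mat n) : Mat n := fun i j => max (A i j) (B i j)

/-- Max-plus matrix product. -/
def mul (A B : Mat n) : Mat n := fun i j => Finset.univ.sup fun k => A i k + B k j

/-- Max-plus identity matrix. -/
def idm : Mat n := fun i j => if i = j then 0 else ⊥

/-- Max-plus matrix power. -/
def pow (A : Mat n) : ℕ → Mat n
  | 0 => idm
  | t + 1 => mul A (pow A t)

/-- The arc relation of the digraph `D(A)`. -/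
def arc (A : Mat n) (i j : Fin n) : Prop := A i j ≠ ⊥

/-- `W` is a walk of the digraph with arc relation `R` (a nonempty list of nodes,
consecutive nodes joined by arcs). -/
def IsWalk (R : Fin n → Fin n → Prop) (W : List (Fin n)) : Prop := W ≠ [] ∧ W.Chain' R

/-- `W` is a walk from `i` to `j`. -/
def IsWalkFrom (R : Fin n → Fin n → Prop) (W : List (Fin n)) (i j : Fin n) : Prop :=
  IsWalk R W ∧ W.head? = some i ∧ W.getLast? = some j

/-- The length of a walk: its number of arcs (= number of nodes minus one). -/
def len (W : List (Fin n)) : ℕ := W.length - 1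

/-- The weight `p(W)` of a walk: the max-plus product (= sum) of its arc weights. -/
def weight (A : Mat n) (W : List (Fin n)) : Rmax :=
  ((W.zip W.tail).map fun p => A p.1 p.2).sum

/-- A cycle: a closed walk of positive length with no proper closed subwalk. -/
def IsCycle (R : Fin n → Fin n → Prop) (W : List (Fin n)) : Prop :=
  2 ≤ W.length ∧ W.Chain' R ∧ W.head? = W.getLast? ∧ W.dropLast.Nodup

/-- The mean weight of a cycle: its weight divided by its length. -/
def mean (A : Mat n) (W : List (Fin n)) : Rmax :=
  (weight A W).map fun r => r / (len W : ℝ)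

/-- The maximum cycle mean `λ(A)` (equal to `⊥ = -∞` if there are no cycles). -/
def lam (A : Mat n) : Rmax := sSup {m | ∃ W, IsCycle (arc A) W ∧ m = mean A W}

/-- A critical cycle: a cycle of `D(A)` attaining the maximum cycle mean. -/
def IsCritCycle (A : Mat n) (W : List (Fin n)) : Prop :=
  IsCycle (arc A) W ∧ mean A W = lam A

/-- A node of the critical graph `C(A)`. -/
def critNode (A : Mat n) (i : Fin n) : Prop := ∃ W, IsCritCycle A W ∧ i ∈ W

/-- An arc of the critical graph `C(A)`. -/
def critArc (A : Mat n) (i j : Fin n) : Prop :=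
  ∃ W, IsCritCycle A W ∧ (i, j) ∈ W.zip W.tail

/-- Reachability in the digraph with arc relation `R`. -/
def reach (R : Fin n → Fin n → Prop) (i j : Fin n) : Prop := ∃ W, IsWalkFrom R W i j

/-- `i` and `j` lie in the same strongly connected component. -/
def sameSCC (R : Fin n → Fin n → Prop) (i j : Fin n) : Prop := reach R i j ∧ reach R j i

/-- `i` lies on some cycle of the digraph. -/
def onCycle (R : Fin n → Fin n → Prop) (i : Fin n) : Prop := ∃ W, IsCycle R W ∧ i ∈ W

/-- The girth of the strongly connected component of `i`: the minimal length of a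
cycle meeting that component. -/
def girthAt (R : Fin n → Fin n → Prop) (i : Fin n) : ℕ :=
  sInf {t | ∃ W, IsCycle R W ∧ (∃ v ∈ W, sameSCC R i v) ∧ len W = t}

/-- The maximal girth of a (completely reducible) digraph: the maximum of the girths
of its strongly connected components. -/
def maxGirth (R : Fin n → Fin n → Prop) : ℕ :=
  sSup {g | ∃ i, onCycle R i ∧ girthAt R i = g}

/-- The gcd of the cycle lengths in the strongly connected component of `i`
(described as the greatest common divisor of all such cycle lengths). -/
def sccGcd (R : Fin n → Fin n → Prop) (i : Fin n) : ℕ :=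
  sSup {d | ∀ W, IsCycle R W → (∃ v ∈ W, sameSCC R i v) → d ∣ len W}

/-- The cyclicity of a (completely reducible) digraph: the lcm over its strongly
connected components of the gcds of their cycle lengths. -/
def cyclicity (R : Fin n → Fin n → Prop) : ℕ :=
  (Finset.univ.filter fun i => onCycle R i).lcm (sccGcd R)

/-- Kleene star `X^* = I ⊕ X ⊕ ⋯ ⊕ X^{n-1}`. -/
def star (A : Mat n) : Mat n := fun i j => (Finset.range n).sup fun k => pow A k i j

/-- Scalar (max-plus) multiplication of a matrix. -/
def smul (c : Rmax) (A : Mat n) : Mat n := fun i j => c + A i j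

/-- Max-plus negation (inversion) of a scalar. -/
def negB : Rmax → Rmax := WithBot.map Neg.neg

/-- The CSR term `CS^tR[A]`. -/
def csr (A : Mat n) (t : ℕ) : Mat n :=
  if lam A = ⊥ then fun _ _ => ⊥ else
    let M := star (pow (smul (negB (lam A)) A) (cyclicity (critArc A)))
    let C : Mat n := fun i j => if critNode A j then M i j else ⊥
    let S : Mat n := fun i j => if critArc A i j then A i j else ⊥
    let R : Mat n := fun i j => if critNode A i then M i j else ⊥
    mul C (mul (pow S t) R)

/-- The Nachtigall matrix `B_N`: entries with a critical index are set to `-∞`. -/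
def bN (A : Mat n) : Mat n := fun i j => if critNode A i ∨ critNode A j then ⊥ else A i j

/-- The weak CSR threshold `T₁(A) = T₁(A, B_N)`. -/
def T1 (A : Mat n) : ℕ :=
  sInf {T | ∀ t, T ≤ t → pow A t = oplus (csr A t) (pow (bN A) t)}

/-- The Dulmage–Mendelsohn bound `DM(g,n) = g(n-2) + n`. -/
def DM (g N : ℕ) : ℕ := g * (N - 2) + N

/-- The Wielandt bound `Wi(n)`. -/
def Wi (N : ℕ) : ℕ := if N = 1 then 0 else (N - 1) ^ 2 + 1

/-- The matrix `A₁` (0-indexed version of Equation (5) of the paper): it keeps the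
arcs `(i,i+1)` for `1 ≤ i ≤ n-1`, `(n,1)` and `(g,1)` of `A` (in 1-indexed terms). -/
def A1 (A : Mat n) (g : ℕ) : Mat n := fun i j =>
  if j.val = i.val + 1 ∨ (i.val = n - 1 ∧ j.val = 0) ∨ (i.val = g - 1 ∧ j.val = 0)
  then A i j else ⊥

/-- The matrix `B₁`: it keeps the arcs `(i,j)` with `i > g`, `j > g`,
`j ≡ i+1 (mod g)` (in 1-indexed terms). -/
def B1 (A : Mat n) (g : ℕ) : Mat n := fun i j =>
  if g ≤ i.val ∧ g ≤ j.val ∧ j.val % g = (i.val + 1) % g then A i j else ⊥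

/-- The matrix `A₂`: the remaining entries of `A`. -/
def A2 (A : Mat n) (g : ℕ) : Mat n := fun i j =>
  if oplus (A1 A g) (B1 A g) i j ≠ ⊥ then ⊥ else A i j

/-- Strict domination of matrices: `X < Y` entrywise, equality allowed only at `-∞`. -/
def mLt (X Y : Mat n) : Prop := ∀ i j, X i j < Y i j ∨ (X i j = ⊥ ∧ Y i j = ⊥)

/-- The cycle `1 2 ⋯ g 1` (0-indexed: the node list `[0,1,…,g-1,0]`). -/
def stdCyc (N g : ℕ) : List (Fin N) := (List.finRange N).take g ++ (List.finRange N).take 1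

/-- The node list of the walk `(g+1)⋯n(1⋯n)^g` (0-indexed). -/
def wInteresting (N g : ℕ) : List (Fin N) :=
  (List.finRange N).drop g ++ (List.replicate g (List.finRange N)).flatten

/-- The node list of the walk `n(1⋯(n-1))^{n-1}1⋯n` (0-indexed). -/
def wWielandt (N : ℕ) : List (Fin N) :=
  (List.finRange N).drop (N - 1) ++
    (List.replicate (N - 1) ((List.finRange N).take (N - 1))).flatten ++ List.finRange N

/-- Walks from `i` to `j` through a node of `Z₀` whose length is `≡ m (mod γ)`. -/
def ThroughSet (A : Mat n) (Z0 : List (Fin n)) (i j : Fin n) (γ m : ℕ) :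
    Set (List (Fin n)) :=
  {V | IsWalkFrom (arc A) V i j ∧ (∃ v ∈ V, v ∈ Z0) ∧ len V % γ = m % γ}

/-- A twice optimal walk: of minimal length among the walks of maximal weight in
`ThroughSet A Z0 i j γ m`. -/
def TwiceOpt (A : Mat n) (Z0 : List (Fin n)) (i j : Fin n) (γ m : ℕ)
    (W : List (Fin n)) : Prop :=
  W ∈ ThroughSet A Z0 i j γ m ∧
  (∀ V ∈ ThroughSet A Z0 i j γ m, weight A V ≤ weight A W) ∧
  (∀ V ∈ ThroughSet A Z0 i j γ m, weight A V = weight A W → len W ≤ len V)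

/-- An interesting walk: twice optimal (for residue `DM(g,n) - 1` modulo `g`) of
length `DM(g,n) + g - 1`. -/
def Interesting (A : Mat n) (g : ℕ) (Z0 : List (Fin n)) (i j : Fin n)
    (W : List (Fin n)) : Prop :=
  TwiceOpt A Z0 i j g (DM g n - 1) W ∧ len W = DM g n + g - 1

/-- The index of a digraph: the transient of its Boolean adjacency matrix. -/
def Tind (R : Fin n → Fin n → Prop) : ℕ :=
  sInf {T | ∀ t, T ≤ t → ∀ i j : Fin n,
    (∃ W, IsWalkFrom R W i j ∧ len W = t) ↔
      (∃ W, IsWalkFrom R W i j ∧ len W = t + cyclicity R)}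

/-- The transient of row `i` of `A`. -/
def rowTrans (A : Mat n) (i : Fin n) : ℕ :=
  sInf {T | ∀ t, T ≤ t → ∀ j, pow A t i j = csr A t i j}

/-- The transient of column `i` of `A`. -/
def colTrans (A : Mat n) (i : Fin n) : ℕ :=
  sInf {T | ∀ t, T ≤ t → ∀ j, pow A t j i = csr A t j i}

/-- The maximum of the transients of the critical rows and columns of `A`. -/
def critTransMax (A : Mat n) : ℕ :=
  (Finset.univ.filter fun i => critNode A i).sup fun i =>
    max (rowTrans A i) (colTrans A i)

/-- Renumbering of the nodes of `A` by a permutation `σ`. -/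
def renum (σ : Equiv.Perm (Fin n)) (A : Mat n) : Mat n := fun i j => A (σ i) (σ j)

end MaxPlus

namespace MaxPlus

variable {n : ℕ}

/-- `i :: l` is a walk from `i` to `j` in the digraph with arc relation `R`. -/
def Trail (R : Fin n → Fin n → Prop) : Fin n → List (Fin n) → Fin n → Prop
  | i, [], j => i = j
  | i, k :: l, j => R i k ∧ Trail R k l j

/-- The weight of the walk `i :: l`. -/
def trailWeight (A : Mat n) : Fin n → List (Fin n) → Rmax
  | _, [] => 0
  | i, k :: l => A i k + trailWeight A k l

theorem isWalkFrom_def {R : Fin n → Fin n → Prop} {i j : Fin n} {W : List (Fin n)} :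
    IsWalkFrom R W i j ↔
      (W ≠ [] ∧ W.IsChain R) ∧ W.head? = some i ∧ W.getLast? = some j :=
  Iff.rfl

theorem isWalkFrom_cons_iff {R : Fin n → Fin n → Prop} {i k j : Fin n} {l : List (Fin n)} :
    IsWalkFrom R (k :: l) i j ↔ k = i ∧ Trail R i l j := by
  induction l generalizing i k with
  | nil =>
    simp only [isWalkFrom_def, Trail]
    simp +contextual
  | cons a l ih =>
    have := @ih a a
    simp only [isWalkFrom_def, Trail, List.isChain_cons_cons] at this ⊢
    simp only [List.head?_cons, List.getLast?_cons_cons] at this ⊢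
    constructor
    · rintro ⟨⟨-, h1, h2⟩, h3, h4⟩
      obtain rfl : k = i := by simpa using h3
      exact ⟨rfl, h1, (this.1 ⟨⟨by simp, h2⟩, trivial, h4⟩).2⟩
    · rintro ⟨rfl, h1, h2⟩
      obtain ⟨⟨-, h3⟩, -, h4⟩ := this.2 ⟨trivial, h2⟩
      exact ⟨⟨by simp, h1, h3⟩, rfl, h4⟩

theorem isWalkFrom_iff {R : Fin n → Fin n → Prop} {i j : Fin n} {W : List (Fin n)} :
    IsWalkFrom R W i j ↔ ∃ l, W = i :: l ∧ Trail R i l j := by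
  cases W with
  | nil => simp [isWalkFrom_def]
  | cons k l =>
    rw [isWalkFrom_cons_iff]
    constructor
    · rintro ⟨rfl, h⟩
      exact ⟨l, rfl, h⟩
    · rintro ⟨l', h, h'⟩
      obtain ⟨rfl, rfl⟩ := List.cons.inj h
      exact ⟨rfl, h'⟩

theorem weight_cons (A : Mat n) (i : Fin n) (l : List (Fin n)) :
    weight A (i :: l) = trailWeight A i l := by
  induction l generalizing i with
  | nil => rfl
  | cons a l ih => rw [trailWeight, ← ih]; rfl

theorem len_cons (i : Fin n) (l : List (Fin n)) : len (i :: l) = l.length := by simp [len]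

theorem Trail.append {R : Fin n → Fin n → Prop} {i k j : Fin n} {l m : List (Fin n)}
    (h : Trail R i l k) (h' : Trail R k m j) : Trail R i (l ++ m) j := by
  induction l generalizing i with
  | nil => obtain rfl : i = k := h; exact h'
  | cons a l ih => exact ⟨h.1, ih h.2⟩

theorem Trail.of_append {R : Fin n → Fin n → Prop} {i j : Fin n} {l m : List (Fin n)}
    (h : Trail R i (l ++ m) j) : ∃ k, Trail R i l k ∧ Trail R k m j := by
  induction l generalizing i with
  | nil => exact ⟨i, rfl, h⟩
  | cons a l ih =>
    obtain ⟨k, h1, h2⟩ := ih h.2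
    exact ⟨k, ⟨h.1, h1⟩, h2⟩

theorem Trail.mono {R R' : Fin n → Fin n → Prop} (hR : ∀ u v, R u v → R' u v) {i j : Fin n}
    {l : List (Fin n)} (h : Trail R i l j) : Trail R' i l j := by
  induction l generalizing i with
  | nil => exact h
  | cons a l ih => exact ⟨hR _ _ h.1, ih h.2⟩

theorem Trail.mem {R : Fin n → Fin n → Prop} {i j : Fin n} {l : List (Fin n)}
    (h : Trail R i l j) : j ∈ i :: l := by
  induction l generalizing i with
  | nil => obtain rfl : i = j := h; simp
  | cons a l ih => exact List.mem_cons_of_mem _ (ih h.2)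

theorem Trail.trailWeight_append {R : Fin n → Fin n → Prop} (A : Mat n) {i k : Fin n}
    {l : List (Fin n)} (h : Trail R i l k) (m : List (Fin n)) :
    trailWeight A i (l ++ m) = trailWeight A i l + trailWeight A k m := by
  induction l generalizing i with
  | nil => obtain rfl : i = k := h; simp [trailWeight]
  | cons a l ih => simp [trailWeight, ih h.2, add_assoc]

theorem Trail.exists_split {R : Fin n → Fin n → Prop} {i j v : Fin n} {l : List (Fin n)}
    (h : Trail R i l j) (hv : v ∈ i :: l) :
    ∃ l₁ l₂, l = l₁ ++ l₂ ∧ Trail R i l₁ v ∧ Trail R v l₂ j := by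
  induction l generalizing i with
  | nil =>
    obtain rfl : v = i := by simpa using hv
    exact ⟨[], [], rfl, rfl, h⟩
  | cons a l ih =>
    by_cases hvi : v = i
    · subst hvi
      exact ⟨[], a :: l, rfl, rfl, h⟩
    · obtain ⟨l₁, l₂, rfl, h1, h2⟩ := ih h.2 (by simpa [hvi] using hv)
      exact ⟨a :: l₁, l₂, rfl, ⟨h.1, h1⟩, h2⟩

/-- A concatenation of closed walks based at `v` is a closed walk based at `v`. -/
theorem Trail.flatten {R : Fin n → Fin n → Prop} {v : Fin n} {cs : List (List (Fin n))}
    (h : ∀ c ∈ cs, Trail R v c v) : Trail R v cs.flatten v := by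
  induction cs with
  | nil => rfl
  | cons c cs ih =>
    exact (h c (by simp)).append (ih fun c hc => h c (List.mem_cons_of_mem _ hc))

/-- A walk visiting `v` exactly `k + 1` times splits at these visits into a walk to `v`,
`k` nonempty closed walks based at `v`, and a walk from `v`. -/
theorem Trail.exists_decomp {R : Fin n → Fin n → Prop} {i j v : Fin n} {l : List (Fin n)}
    (h : Trail R i l j) {k : ℕ} (hk : (i :: l).count v = k + 1) :
    ∃ (l₀ : List (Fin n)) (cs : List (List (Fin n))) (l₁ : List (Fin n)),
      cs.length = k ∧ l = l₀ ++ cs.flatten ++ l₁ ∧ Trail R i l₀ v ∧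
      (∀ c ∈ cs, Trail R v c v ∧ c ≠ []) ∧ Trail R v l₁ j := by
  induction l generalizing i k with
  | nil =>
    have hiv : i = v := by
      by_contra hne
      simp [hne] at hk
    subst hiv
    have : k = 0 := by simpa using hk.symm
    exact ⟨[], [], [], by simp [this], rfl, rfl, by simp, h⟩
  | cons a l ih =>
    by_cases hiv : i = v
    · subst hiv
      rw [List.count_cons_self] at hk
      cases k with
      | zero => exact ⟨[], [], a :: l, rfl, rfl, rfl, by simp, h⟩
      | succ k =>
        obtain ⟨l₀, cs, l₁, h1, rfl, h3, h4, h5⟩ := ih h.2 (k := k) (by omega)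
        refine ⟨[], (a :: l₀) :: cs, l₁, by simp [h1], by simp, rfl, ?_, h5⟩
        intro c hc
        rcases List.mem_cons.1 hc with rfl | hc
        · exact ⟨⟨h.1, h3⟩, by simp⟩
        · exact h4 c hc
    · rw [List.count_cons_of_ne hiv] at hk
      obtain ⟨l₀, cs, l₁, h1, rfl, h3, h4, h5⟩ := ih h.2 hk
      exact ⟨a :: l₀, cs, l₁, h1, rfl, ⟨h.1, h3⟩, h4, h5⟩

/-- A walk with a repeated node contains a nonempty closed walk. -/
theorem Trail.exists_closed {R : Fin n → Fin n → Prop} {i j : Fin n} {l : List (Fin n)}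
    (h : Trail R i l j) (hd : ¬ (i :: l).Nodup) :
    ∃ (v : Fin n) (l₁ l₂ l₃ : List (Fin n)), l = l₁ ++ l₂ ++ l₃ ∧ l₂ ≠ [] ∧
      Trail R i l₁ v ∧ Trail R v l₂ v ∧ Trail R v l₃ j := by
  rw [List.nodup_iff_count_le_one] at hd
  push Not at hd
  obtain ⟨v, hv⟩ := hd
  obtain ⟨k, hk⟩ : ∃ k, (i :: l).count v = k + 1 + 1 := ⟨(i :: l).count v - 2, by omega⟩
  obtain ⟨l₀, cs, l₁, h1, rfl, h3, h4, h5⟩ := h.exists_decomp hk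
  refine ⟨v, l₀, cs.flatten, l₁, rfl, ?_, h3, Trail.flatten fun c hc => (h4 c hc).1, h5⟩
  cases cs with
  | nil => simp at h1
  | cons c cs => simp [(h4 c (by simp)).2]

/-- Among `g` lists, some consecutive ones have total length divisible by `g`. -/
theorem exists_block_dvd {α : Type*} {g : ℕ} (hg : 0 < g) (cs : List (List α))
    (hcs : g ≤ cs.length) :
    ∃ x y z : List (List α), cs = x ++ y ++ z ∧ y ≠ [] ∧ g ∣ y.flatten.length := by
  obtain ⟨a, b, hab, hmod⟩ : ∃ a b : Fin (g + 1), a < b ∧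
      (cs.take a).flatten.length % g = (cs.take b).flatten.length % g := by
    have := Fintype.exists_ne_map_eq_of_card_lt
      (fun a : Fin (g + 1) => (⟨(cs.take a).flatten.length % g, Nat.mod_lt _ hg⟩ : Fin g))
      (by simp)
    obtain ⟨a, b, hne, h⟩ := this
    have h' := congrArg Fin.val h
    rcases lt_or_gt_of_ne hne with hlt | hlt
    · exact ⟨a, b, hlt, h'⟩
    · exact ⟨b, a, hlt, h'.symm⟩
  have hab' : (a : ℕ) < b := hab
  have hb : (b : ℕ) ≤ g := Nat.lt_succ_iff.1 b.2
  have hsplit : cs.take b = cs.take a ++ (cs.take b).drop a := by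
    conv_lhs => rw [← List.take_append_drop (a : ℕ) (cs.take b)]
    rw [List.take_take, min_eq_left hab'.le]
  refine ⟨cs.take a, (cs.take b).drop a, cs.drop b, ?_, ?_, ?_⟩
  · rw [← hsplit, List.take_append_drop]
  · intro h
    have := congrArg List.length h
    simp at this
    omega
  · rw [hsplit, List.flatten_append, List.length_append] at hmod
    exact (Nat.modEq_iff_dvd' (Nat.le_add_right _ _)).1 hmod |>.trans (by simp)

theorem exists_eq_mul (A B : Mat n) (i j : Fin n) : ∃ k, mul A B i j = A i k + B k j := by
  obtain ⟨k, -, hk⟩ := Finset.exists_mem_eq_sup Finset.univ ⟨i, Finset.mem_univ i⟩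
    fun k => A i k + B k j
  exact ⟨k, hk⟩

theorem le_mul (A B : Mat n) (i k j : Fin n) : A i k + B k j ≤ mul A B i j :=
  Finset.le_sup (f := fun k => A i k + B k j) (Finset.mem_univ k)

theorem mul_assoc' (A B C : Mat n) : mul (mul A B) C = mul A (mul B C) := by
  ext i j : 2
  apply le_antisymm
  · obtain ⟨k, hk⟩ := exists_eq_mul (mul A B) C i j
    obtain ⟨l, hl⟩ := exists_eq_mul A B i k
    rw [hk, hl, add_assoc]
    exact (add_le_add le_rfl (le_mul B C l k j)).trans (le_mul _ _ _ _ _)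
  · obtain ⟨k, hk⟩ := exists_eq_mul A (mul B C) i j
    obtain ⟨l, hl⟩ := exists_eq_mul B C k j
    rw [hk, hl, ← add_assoc]
    exact (add_le_add (le_mul A B i k l) le_rfl).trans (le_mul _ _ _ _ _)

theorem idm_mul (A : Mat n) : mul idm A = A := by
  ext i j : 2
  apply le_antisymm
  · obtain ⟨k, hk⟩ := exists_eq_mul idm A i j
    rw [hk, idm]
    split_ifs with h
    · rw [h, zero_add]
    · simp
  · simpa [idm] using le_mul idm A i i j

theorem pow_add' (A : Mat n) (a b : ℕ) : pow A (a + b) = mul (pow A a) (pow A b) := by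
  induction a with
  | zero => rw [Nat.zero_add, pow, idm_mul]
  | succ a ih => rw [Nat.add_right_comm, pow, pow, ih, mul_assoc']

theorem pow_pow' (A : Mat n) (a b : ℕ) : pow (pow A a) b = pow A (a * b) := by
  induction b with
  | zero => rfl
  | succ b ih => rw [pow, ih, Nat.mul_succ, Nat.add_comm (a * b), pow_add']

theorem pow_add_le (A : Mat n) (a b : ℕ) (i k j : Fin n) :
    pow A a i k + pow A b k j ≤ pow A (a + b) i j := by
  rw [pow_add']
  exact le_mul _ _ _ _ _

theorem exists_pow_add_eq (A : Mat n) (a b : ℕ) (i j : Fin n) :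
    ∃ k, pow A (a + b) i j = pow A a i k + pow A b k j := by
  rw [pow_add']
  exact exists_eq_mul _ _ _ _

theorem pow_mono {A B : Mat n} (h : ∀ i j, A i j ≤ B i j) (t : ℕ) (i j : Fin n) :
    pow A t i j ≤ pow B t i j := by
  induction t generalizing i with
  | zero => exact le_rfl
  | succ t ih =>
    obtain ⟨k, hk⟩ := exists_eq_mul A (pow A t) i j
    rw [pow, hk]
    exact (add_le_add (h _ _) (ih k)).trans (le_mul _ _ _ _ _)

theorem zero_le_pow_mul {A : Mat n} {c : ℕ} {v : Fin n} (h : 0 ≤ pow A c v v) (m : ℕ) :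
    0 ≤ pow A (c * m) v v := by
  induction m with
  | zero => simp [pow, idm]
  | succ m ih =>
    rw [Nat.mul_succ]
    exact (add_nonneg ih h).trans (pow_add_le _ _ _ _ _ _)

theorem Trail.trailWeight_le_pow {R : Fin n → Fin n → Prop} {A : Mat n} {i j : Fin n}
    {l : List (Fin n)} (h : Trail R i l j) : trailWeight A i l ≤ pow A l.length i j := by
  induction l generalizing i with
  | nil =>
    obtain rfl : i = j := h
    simp [trailWeight, pow, idm]
  | cons a l ih => exact (add_le_add le_rfl (ih h.2)).trans (le_mul _ _ _ _ _)

theorem exists_trail_of_pow_ne_bot {A : Mat n} {t : ℕ} {i j : Fin n} (h : pow A t i j ≠ ⊥) :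
    ∃ l, Trail (arc A) i l j ∧ l.length = t ∧ trailWeight A i l = pow A t i j := by
  induction t generalizing i with
  | zero =>
    have hij : i = j := by
      by_contra hne
      simp [pow, idm, hne] at h
    subst hij
    exact ⟨[], rfl, rfl, by simp [pow, idm, trailWeight]⟩
  | succ t ih =>
    obtain ⟨k, hk⟩ := exists_eq_mul A (pow A t) i j
    rw [pow, hk, WithBot.add_ne_bot] at h
    obtain ⟨l, h1, h2, h3⟩ := ih h.2
    exact ⟨k :: l, ⟨h.1, h1⟩, by simp [h2], by rw [trailWeight, h3, pow, hk]⟩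

/-- If closed walks have nonpositive weight, the Kleene star dominates all powers. -/
theorem pow_le_star {B : Mat n} (hB : ∀ m v, pow B m v v ≤ 0) (k : ℕ) (i j : Fin n) :
    pow B k i j ≤ star B i j := by
  induction k using Nat.strong_induction_on with
  | _ k ih =>
    by_cases hk : k < n
    · exact Finset.le_sup (f := fun k => pow B k i j) (Finset.mem_range.2 hk)
    by_cases hbot : pow B k i j = ⊥
    · simp [hbot]
    obtain ⟨l, hl, rfl, hw⟩ := exists_trail_of_pow_ne_bot hbot
    have hd : ¬ (i :: l).Nodup := by
      intro hd
      have := hd.length_le_card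
      simp at this
      omega
    obtain ⟨v, l₁, l₂, l₃, rfl, hne, h1, h2, h3⟩ := hl.exists_closed hd
    have hpos := List.length_pos_of_ne_nil hne
    have hle := h2.trailWeight_le_pow.trans (hB l₂.length v)
    calc pow B (l₁ ++ l₂ ++ l₃).length i j
        = trailWeight B i l₁ + trailWeight B v l₂ + trailWeight B v l₃ := by
          rw [← hw, (h1.append h2).trailWeight_append, h1.trailWeight_append]
      _ ≤ trailWeight B i l₁ + 0 + trailWeight B v l₃ := by gcongr
      _ = trailWeight B i (l₁ ++ l₃) := by rw [add_zero, h1.trailWeight_append]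
      _ ≤ pow B (l₁ ++ l₃).length i j := (h1.append h3).trailWeight_le_pow
      _ ≤ star B i j := ih _ (by simp only [List.length_append]; omega)

theorem isCycle_iff {R : Fin n → Fin n → Prop} {W : List (Fin n)} :
    IsCycle R W ↔ ∃ z l, W = z :: l ∧ l ≠ [] ∧ Trail R z l z ∧ (z :: l).dropLast.Nodup := by
  have hdef : IsCycle R W ↔
    2 ≤ W.length ∧ W.IsChain R ∧ W.head? = W.getLast? ∧ W.dropLast.Nodup := Iff.rfl
  rw [hdef]
  cases W with
  | nil => simp
  | cons z l =>
    constructor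
    · rintro ⟨h1, h2, h3, h4⟩
      refine ⟨z, l, rfl, ?_, ?_, h4⟩
      · rintro rfl
        simp at h1
      · exact (isWalkFrom_cons_iff.1 (isWalkFrom_def.2 ⟨⟨by simp, h2⟩, rfl, h3.symm⟩)).2
    · rintro ⟨z', l', h, h1, h2, h3⟩
      obtain ⟨rfl, rfl⟩ := List.cons.inj h
      obtain ⟨⟨-, h4⟩, h5, h6⟩ := isWalkFrom_def.1 (isWalkFrom_cons_iff.2 ⟨rfl, h2⟩)
      have := List.length_pos_of_ne_nil h1
      exact ⟨by simp only [List.length_cons]; omega, h4, h5.trans h6.symm, h3⟩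

theorem finite_isCycle (R : Fin n → Fin n → Prop) : {W | IsCycle R W}.Finite := by
  refine (List.finite_length_le (Fin n) (n + 1)).subset fun W hW => ?_
  have := hW.2.2.2.length_le_card
  simp at this ⊢
  omega

theorem mean_le_lam {A : Mat n} {W : List (Fin n)} (h : IsCycle (arc A) W) :
    mean A W ≤ lam A := by
  refine le_csSup (Set.Finite.bddAbove ?_) ⟨W, h, rfl⟩
  refine ((finite_isCycle (arc A)).image (mean A)).subset ?_
  rintro _ ⟨W, hW, rfl⟩
  exact ⟨W, hW, rfl⟩

theorem len_pos_of_isCycle {R : Fin n → Fin n → Prop} {W : List (Fin n)} (h : IsCycle R W) :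
    0 < len W := by
  have := h.1
  unfold len
  omega

theorem weight_nonpos_of_mean_nonpos {A : Mat n} {W : List (Fin n)} (hlen : 0 < len W)
    (h : mean A W ≤ 0) : weight A W ≤ 0 := by
  unfold mean at h
  cases hw : weight A W using WithBot.recBotCoe with
  | bot => simp
  | coe r =>
    rw [hw, WithBot.map_coe] at h
    have h' : r / (len W : ℝ) ≤ 0 := by exact_mod_cast h
    have hl : (0 : ℝ) < len W := by exact_mod_cast hlen
    have : r ≤ 0 := by
      rw [div_le_iff₀ hl] at h'
      simpa using h'
    exact_mod_cast this

theorem weight_eq_zero_of_mean_eq_zero {A : Mat n} {W : List (Fin n)} (hlen : 0 < len W)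
    (h : mean A W = 0) : weight A W = 0 := by
  unfold mean at h
  cases hw : weight A W using WithBot.recBotCoe with
  | bot => simp [hw] at h
  | coe r =>
    rw [hw, WithBot.map_coe] at h
    have h' : r / (len W : ℝ) = 0 := by exact_mod_cast h
    have hl : (len W : ℝ) ≠ 0 := by exact_mod_cast hlen.ne'
    have : r = 0 := by simpa [hl] using h'
    simp [this]

/-- If `λ(A) = 0`, closed walks have nonpositive weight. -/
theorem Trail.trailWeight_nonpos {A : Mat n} (hlam : lam A = 0) {v : Fin n}
    {l : List (Fin n)} (h : Trail (arc A) v l v) : trailWeight A v l ≤ 0 := by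
  induction hN : l.length using Nat.strong_induction_on generalizing v l with
  | _ N ih =>
    rcases List.eq_nil_or_concat l with rfl | ⟨l', x, rfl⟩
    · simp [trailWeight]
    by_cases hd : (v :: l').Nodup
    · have hcyc : IsCycle (arc A) (v :: (l' ++ [x])) := by
        refine isCycle_iff.2 ⟨v, l' ++ [x], rfl, by simp, by simpa using h, ?_⟩
        rw [← List.cons_append, List.dropLast_concat]
        exact hd
      have := weight_nonpos_of_mean_nonpos (len_pos_of_isCycle hcyc)
        (hlam ▸ mean_le_lam hcyc)
      rw [weight_cons] at this
      simpa using this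
    · rw [List.concat_eq_append] at h hN ⊢
      obtain ⟨u, h1, h2⟩ := h.of_append
      obtain ⟨w, l₁, l₂, l₃, rfl, hne, h3, h4, h5⟩ := h1.exists_closed hd
      have hpos := List.length_pos_of_ne_nil hne
      simp only [List.length_append, List.length_cons, List.length_nil] at hN
      have e1 := ih l₂.length (by omega) h4 rfl
      have e2 := ih (l₁ ++ (l₃ ++ [x])).length
        (by simp only [List.length_append, List.length_cons, List.length_nil]; omega)
        (h3.append (h5.append h2)) rfl
      rw [h3.trailWeight_append, h5.trailWeight_append] at e2
      rw [h1.trailWeight_append, (h3.append h4).trailWeight_append, h3.trailWeight_append]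
      calc _ = trailWeight A w l₂ + (trailWeight A v l₁ +
            (trailWeight A w l₃ + trailWeight A u [x])) := by abel
        _ ≤ 0 := add_nonpos e1 e2

theorem pow_self_nonpos {A : Mat n} (hlam : lam A = 0) (t : ℕ) (v : Fin n) :
    pow A t v v ≤ 0 := by
  by_cases hbot : pow A t v v = ⊥
  · simp [hbot]
  obtain ⟨l, hl, -, hw⟩ := exists_trail_of_pow_ne_bot hbot
  exact hw ▸ hl.trailWeight_nonpos hlam

theorem Trail.exists_arc_split {R : Fin n → Fin n → Prop} {i j u v : Fin n}
    {l : List (Fin n)} (h : Trail R i l j) (huv : (u, v) ∈ (i :: l).zip l) :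
    ∃ l₁ l₂, l = l₁ ++ v :: l₂ ∧ Trail R i l₁ u ∧ R u v ∧ Trail R v l₂ j := by
  induction l generalizing i with
  | nil => simp at huv
  | cons a l ih =>
    rw [List.zip_cons_cons, List.mem_cons] at huv
    rcases huv with huv | huv
    · obtain ⟨rfl, rfl⟩ := Prod.mk.inj huv
      exact ⟨[], l, rfl, rfl, h.1, h.2⟩
    · obtain ⟨l₁, l₂, rfl, h1, h2, h3⟩ := ih h.2 huv
      exact ⟨a :: l₁, l₂, rfl, ⟨h.1, h1⟩, h2, h3⟩

theorem Trail.trail_zip {R : Fin n → Fin n → Prop} {i j : Fin n} {l : List (Fin n)}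
    (h : Trail R i l j) : Trail (fun u v => (u, v) ∈ (i :: l).zip l) i l j := by
  induction l generalizing i with
  | nil => exact h
  | cons a l ih =>
    exact ⟨by simp, (ih h.2).mono fun u v huv =>
      by rw [List.zip_cons_cons]; exact List.mem_cons_of_mem _ huv⟩

/-- A closed walk can be started at any of its nodes. -/
theorem Trail.exists_rotate {R : Fin n → Fin n → Prop} (A : Mat n) {z v : Fin n}
    {l : List (Fin n)} (h : Trail R z l z) (hv : v ∈ z :: l) :
    ∃ c, Trail R v c v ∧ c.length = l.length ∧ trailWeight A v c = trailWeight A z l := by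
  obtain ⟨l₁, l₂, rfl, h1, h2⟩ := h.exists_split hv
  refine ⟨l₂ ++ l₁, h2.append h1, by simp [Nat.add_comm], ?_⟩
  rw [h1.trailWeight_append, h2.trailWeight_append, add_comm]

theorem IsCritCycle.exists_trail {A : Mat n} (hlam : lam A = 0) {Z : List (Fin n)}
    (hZ : IsCritCycle A Z) :
    ∃ z l, Z = z :: l ∧ l ≠ [] ∧ Trail (critArc A) z l z ∧ Trail (arc A) z l z ∧
      trailWeight A z l = 0 := by
  obtain ⟨z, l, rfl, hne, h, -⟩ := isCycle_iff.1 hZ.1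
  refine ⟨z, l, rfl, hne, h.trail_zip.mono fun u v huv => ⟨_, hZ, huv⟩, h, ?_⟩
  rw [← weight_cons]
  exact weight_eq_zero_of_mean_eq_zero (len_pos_of_isCycle hZ.1) (hZ.2.trans hlam)

theorem IsCritCycle.exists_closed {A : Mat n} (hlam : lam A = 0) {Z : List (Fin n)}
    (hZ : IsCritCycle A Z) {v : Fin n} (hv : v ∈ Z) :
    ∃ c, Trail (critArc A) v c v ∧ c.length = len Z ∧ trailWeight A v c = 0 := by
  obtain ⟨z, l, rfl, -, h, -, hw⟩ := hZ.exists_trail hlam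
  rw [len_cons, ← hw]
  exact h.exists_rotate A hv

theorem IsCritCycle.isCycle_critArc {A : Mat n} (hlam : lam A = 0) {Z : List (Fin n)}
    (hZ : IsCritCycle A Z) : IsCycle (critArc A) Z := by
  obtain ⟨z, l, rfl, hne, h, -⟩ := hZ.exists_trail hlam
  exact isCycle_iff.2 ⟨z, l, rfl, hne, h, hZ.1.2.2.2⟩

/-- The end of a critical arc is joined to its start by a walk of opposite weight. -/
theorem exists_return_of_critArc {A : Mat n} (hlam : lam A = 0) {u v : Fin n}
    (h : critArc A u v) :
    arc A u v ∧ ∃ l, Trail (arc A) v l u ∧ A u v + trailWeight A v l = 0 := by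
  obtain ⟨Z, hZ, huv⟩ := h
  obtain ⟨z, l, rfl, -, -, hl, hw⟩ := hZ.exists_trail hlam
  obtain ⟨l₁, l₂, rfl, h1, h2, h3⟩ := hl.exists_arc_split huv
  refine ⟨h2, l₂ ++ l₁, h3.append h1, ?_⟩
  rw [← hw, h1.trailWeight_append, h3.trailWeight_append, trailWeight]
  abel

theorem Trail.exists_return {A : Mat n} (hlam : lam A = 0) {u v : Fin n} {l : List (Fin n)}
    (h : Trail (critArc A) u l v) :
    ∃ l', Trail (arc A) v l' u ∧ trailWeight A u l + trailWeight A v l' = 0 := by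
  induction l generalizing u with
  | nil => exact ⟨[], Eq.symm h, by simp [trailWeight]⟩
  | cons a l ih =>
    obtain ⟨l₁, h1, hw1⟩ := ih h.2
    obtain ⟨-, l₂, h2, hw2⟩ := exists_return_of_critArc hlam h.1
    refine ⟨l₁ ++ l₂, h1.append h2, ?_⟩
    rw [trailWeight, h1.trailWeight_append]
    calc _ = (A u a + trailWeight A a l₂) +
          (trailWeight A a l + trailWeight A v l₁) := by abel
      _ = 0 := by rw [hw1, hw2, add_zero]

theorem Trail.of_critArc {A : Mat n} (hlam : lam A = 0) {u v : Fin n} {l : List (Fin n)}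
    (h : Trail (critArc A) u l v) : Trail (arc A) u l v :=
  h.mono fun _ _ h => (exists_return_of_critArc hlam h).1

/-- Closed walks of the critical graph have nonnegative weight. -/
theorem Trail.trailWeight_nonneg {A : Mat n} (hlam : lam A = 0) {v : Fin n}
    {l : List (Fin n)} (h : Trail (critArc A) v l v) : 0 ≤ trailWeight A v l := by
  obtain ⟨l', h', hw⟩ := h.exists_return hlam
  rw [← hw]
  simpa using add_le_add (le_refl (trailWeight A v l)) (h'.trailWeight_nonpos hlam)

theorem reach_iff {R : Fin n → Fin n → Prop} {i j : Fin n} :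
    reach R i j ↔ ∃ l, Trail R i l j := by
  constructor
  · rintro ⟨W, hW⟩
    obtain ⟨l, -, h⟩ := isWalkFrom_iff.1 hW
    exact ⟨l, h⟩
  · rintro ⟨l, h⟩
    exact ⟨i :: l, isWalkFrom_iff.2 ⟨l, rfl, h⟩⟩

theorem critNode_of_mem_cycle {A : Mat n} {W : List (Fin n)} {i : Fin n}
    (hW : IsCycle (critArc A) W) (hi : i ∈ W) : critNode A i := by
  obtain ⟨z, l, rfl, hne, h, -⟩ := isCycle_iff.1 hW
  obtain ⟨c, hc, hlen, -⟩ := h.exists_rotate A hi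
  cases c with
  | nil => exact absurd (List.length_eq_zero_iff.1 hlen.symm) hne
  | cons a c =>
    obtain ⟨Z, hZ, hia⟩ := hc.1
    exact ⟨Z, hZ, (List.of_mem_zip hia).1⟩

theorem critNode_of_onCycle {A : Mat n} {i : Fin n}
    (hi : onCycle (critArc A) i) : critNode A i := by
  obtain ⟨W, hW, hiW⟩ := hi
  exact critNode_of_mem_cycle hW hiW

/-- For a strongly connected critical graph, the cyclicity is the greatest common divisor
of the lengths of the critical cycles. -/
theorem dvd_cyclicity_iff {A : Mat n} (hlam : lam A = 0)
    (hSC : ∀ i j, critNode A i → critNode A j → reach (critArc A) i j)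
    {k : Fin n} (hk : critNode A k) (d : ℕ) :
    d ∣ cyclicity (critArc A) ↔ ∀ W, IsCycle (critArc A) W → d ∣ len W := by
  set D : Set ℕ := {d | ∀ W, IsCycle (critArc A) W → d ∣ len W} with hD
  have hscc : ∀ i, critNode A i → sccGcd (critArc A) i = sSup D := by
    intro i hi
    unfold sccGcd
    congr 1
    ext d
    refine forall₂_congr fun W hW => ⟨fun h => ?_, fun h _ => h⟩
    obtain ⟨z, l, rfl, -⟩ := isCycle_iff.1 hW
    have hz := critNode_of_mem_cycle hW List.mem_cons_self
    exact h ⟨z, List.mem_cons_self, hSC i z hi hz, hSC z i hz hi⟩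
  obtain ⟨Z, hZ, hkZ⟩ := hk
  have hZ' := hZ.isCycle_critArc hlam
  have hbdd : BddAbove D := ⟨len Z, fun d hd => Nat.le_of_dvd (len_pos_of_isCycle hZ') (hd Z hZ')⟩
  have hmem : sSup D ∈ D := Nat.sSup_mem ⟨1, fun W _ => one_dvd _⟩ hbdd
  have hpos : 0 < sSup D := Nat.pos_of_dvd_of_pos (hmem Z hZ') (len_pos_of_isCycle hZ')
  have hcyc : cyclicity (critArc A) = sSup D := by
    apply Nat.dvd_antisymm
    · refine Finset.lcm_dvd fun i hi => ?_
      rw [hscc i (critNode_of_onCycle (Finset.mem_filter.1 hi).2)]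
    · rw [← hscc k ⟨Z, hZ, hkZ⟩]
      exact Finset.dvd_lcm (Finset.mem_filter.2 ⟨Finset.mem_univ _, Z, hZ', hkZ⟩)
  rw [hcyc]
  refine ⟨fun h W hW => h.trans (hmem W hW), fun h => ?_⟩
  have hlcm : Nat.lcm d (sSup D) ∈ D := fun W hW => Nat.lcm_dvd (h W hW) (hmem W hW)
  have heq : Nat.lcm d (sSup D) = sSup D :=
    le_antisymm (le_csSup hbdd hlcm) (Nat.le_of_dvd
      (Nat.pos_of_dvd_of_pos (hlcm Z hZ') (len_pos_of_isCycle hZ')) (Nat.dvd_lcm_right _ _))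
  exact heq ▸ Nat.dvd_lcm_left _ _

/-- The matrix of critical arcs. -/
def critMat (A : Mat n) : Mat n := fun i j => if critArc A i j then A i j else ⊥

theorem csr_eq {A : Mat n} (hlam : lam A = 0) (t : ℕ) :
    csr A t =
      mul (fun i j => if critNode A j then star (pow A (cyclicity (critArc A))) i j else ⊥)
        (mul (pow (critMat A) t)
          (fun i j => if critNode A i then star (pow A (cyclicity (critArc A))) i j else ⊥)) := by
  have hsmul : smul (negB 0) A = A := by
    ext i j : 2
    have : negB 0 = 0 := by
      change ((-0 : ℝ) : WithBot ℝ) = 0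
      simp
    simp [smul, this]
  unfold csr
  rw [hlam, if_neg WithBot.zero_ne_bot, hsmul]
  rfl

theorem critMat_le (A : Mat n) (i j : Fin n) : critMat A i j ≤ A i j := by
  unfold critMat
  split_ifs <;> simp

theorem Trail.trailWeight_critMat {A : Mat n} {i j : Fin n} {l : List (Fin n)}
    (h : Trail (critArc A) i l j) : trailWeight (critMat A) i l = trailWeight A i l := by
  induction l generalizing i with
  | nil => rfl
  | cons a l ih => rw [trailWeight, trailWeight, ih h.2, critMat, if_pos h.1]

theorem exists_trail_of_star_ne_bot {A : Mat n} {γ : ℕ} {i j : Fin n}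
    (h : star (pow A γ) i j ≠ ⊥) :
    ∃ l m, Trail (arc A) i l j ∧ l.length = γ * m ∧ trailWeight A i l = star (pow A γ) i j := by
  obtain ⟨m, -, hm⟩ := Finset.exists_mem_eq_sup (Finset.range n)
    ⟨0, Finset.mem_range.2 i.pos⟩ fun k => pow (pow A γ) k i j
  have hm' : star (pow A γ) i j = pow A (γ * m) i j := hm.trans (by rw [pow_pow'])
  rw [hm'] at h ⊢
  obtain ⟨l, h1, h2, h3⟩ := exists_trail_of_pow_ne_bot h
  exact ⟨l, m, h1, h2, h3⟩

/-- Finite CSR entries are weights of walks through critical nodes of suitable length. -/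
theorem exists_trail_of_csr_ne_bot {A : Mat n} (hlam : lam A = 0) {t : ℕ} {i j : Fin n}
    (h : csr A t i j ≠ ⊥) :
    ∃ k p q m, critNode A k ∧ Trail (arc A) i p k ∧ Trail (arc A) k q j ∧
      p.length + q.length = t + cyclicity (critArc A) * m ∧
      csr A t i j ≤ trailWeight A i p + trailWeight A k q := by
  rw [csr_eq hlam] at h ⊢
  obtain ⟨k, hk⟩ := exists_eq_mul (fun i j => if critNode A j then
    star (pow A (cyclicity (critArc A))) i j else ⊥) (mul (pow (critMat A) t)
      (fun i j => if critNode A i then star (pow A (cyclicity (critArc A))) i j else ⊥)) i j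
  obtain ⟨l, hl⟩ := exists_eq_mul (pow (critMat A) t)
      (fun i j => if critNode A i then star (pow A (cyclicity (critArc A))) i j else ⊥) k j
  rw [hk, hl] at h ⊢
  rw [WithBot.add_ne_bot, WithBot.add_ne_bot] at h
  obtain ⟨h1, h2, h3⟩ := h
  have hkc : critNode A k := by
    by_contra hne
    simp [hne] at h1
  have hlc : critNode A l := by
    by_contra hne
    simp [hne] at h3
  simp only [hkc, hlc, if_true] at h1 h3 ⊢
  obtain ⟨p, a, hp, hpl, hpw⟩ := exists_trail_of_star_ne_bot h1
  obtain ⟨q, b, hq, hql, hqw⟩ := exists_trail_of_star_ne_bot h3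
  have hle := pow_mono (critMat_le A) t k l
  obtain ⟨s, hs, hsl, hsw⟩ := exists_trail_of_pow_ne_bot (A := A) (t := t) (i := k) (j := l)
    fun hbot => h2 (by simpa [hbot] using hle)
  refine ⟨k, p, s ++ q, a + b, hkc, hp, hs.append hq, ?_, ?_⟩
  · rw [List.length_append, hpl, hql, hsl]
    ring
  · rw [hs.trailWeight_append, hpw, hqw, hsw]
    gcongr

/-- Walks of length `t` through a critical node are dominated by the CSR term. -/
theorem le_csr {A : Mat n} (hlam : lam A = 0)
    (hSC : ∀ i j, critNode A i → critNode A j → reach (critArc A) i j)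
    {k : Fin n} (hk : critNode A k) (a b : ℕ) (i j : Fin n) :
    pow A a i k + pow A b k j ≤ csr A (a + b) i j := by
  obtain ⟨Z, hZ, hkZ⟩ := id hk
  have hγ := (dvd_cyclicity_iff hlam hSC hk _).1 dvd_rfl Z (hZ.isCycle_critArc hlam)
  have hc := len_pos_of_isCycle hZ.1
  obtain ⟨l, hl, hlen, hw⟩ := hZ.exists_closed hlam hkZ
  have hl0 : 0 ≤ pow (critMat A) (len Z) k k := by
    have := hl.trailWeight_le_pow (A := critMat A)
    rwa [hl.trailWeight_critMat, hlen, hw] at this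
  generalize hcZ : len Z = c at *
  generalize hγd : cyclicity (critArc A) = γ at *
  obtain ⟨c, rfl⟩ : ∃ c', c = c' + 1 := ⟨c - 1, by omega⟩
  set x := c * a with hx
  set y := c * (x + (a + b)) with hy
  have hxy : x + (a + b + y) = (c + 1) * (x + (a + b)) := by rw [hy]; ring
  have h0 := zero_le_pow_mul hl0 (x + (a + b))
  rw [← hxy] at h0
  obtain ⟨k', hk'⟩ := exists_pow_add_eq (critMat A) x (a + b + y) k k
  obtain ⟨l', hl'⟩ := exists_pow_add_eq (critMat A) (a + b) y k' k
  rw [hk', hl'] at h0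
  have hne : pow (critMat A) x k k' + (pow (critMat A) (a + b) k' l' + pow (critMat A) y l' k)
      ≠ ⊥ := fun h => by simp [h] at h0
  rw [WithBot.add_ne_bot, WithBot.add_ne_bot] at hne
  have hcrit : ∀ u v m, pow (critMat A) m u v ≠ ⊥ → reach (critArc A) u v := by
    intro u v m h
    obtain ⟨p, hp, -⟩ := exists_trail_of_pow_ne_bot h
    refine reach_iff.2 ⟨p, hp.mono fun u v huv => ?_⟩
    by_contra hne
    exact huv (if_neg hne)
  have hnode : ∀ u, reach (critArc A) k u → critNode A u := by
    intro u hu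
    obtain ⟨p, hp⟩ := reach_iff.1 hu
    rcases List.eq_nil_or_concat p with rfl | ⟨p, w, rfl⟩
    · obtain rfl : k = u := hp
      exact hk
    · rw [List.concat_eq_append] at hp
      obtain ⟨w', -, ⟨Z', hZ', hmem⟩, rfl⟩ := hp.of_append
      exact ⟨Z', hZ', List.mem_of_mem_tail (List.of_mem_zip hmem).2⟩
  have hk'c := hnode k' (hcrit _ _ _ hne.1)
  have hl'c : critNode A l' := by
    obtain ⟨p, hp⟩ := reach_iff.1 (hcrit _ _ _ hne.1)
    obtain ⟨q, hq⟩ := reach_iff.1 (hcrit _ _ _ hne.2.1)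
    exact hnode l' (reach_iff.2 ⟨p ++ q, hp.append hq⟩)
  have hstar : ∀ m, γ ∣ m → ∀ u v, pow A m u v ≤ star (pow A γ) u v := by
    rintro _ ⟨m, rfl⟩ u v
    rw [← pow_pow']
    refine pow_le_star (fun m v => ?_) m u v
    rw [pow_pow']
    exact pow_self_nonpos hlam _ _
  have hleft : pow A a i k + pow (critMat A) x k k' ≤ star (pow A γ) i k' :=
    ((add_le_add le_rfl (pow_mono (critMat_le A) _ _ _)).trans (pow_add_le A a x i k k')).trans
      (hstar _ (hγ.trans ⟨a, by rw [hx]; ring⟩) _ _)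
  have hdvd : γ ∣ y + b := by
    have h1 : γ ∣ (y + b) + (c + 1) * a :=
      hγ.trans ⟨x + (a + b), by rw [← hxy, hx]; ring⟩
    exact (Nat.dvd_add_iff_left (hγ.mul_right a)).2 h1
  have hright : pow (critMat A) y l' k + pow A b k j ≤ star (pow A γ) l' j :=
    ((add_le_add (pow_mono (critMat_le A) _ _ _) le_rfl).trans (pow_add_le A y b l' k j)).trans
      (hstar _ hdvd _ _)
  rw [csr_eq hlam, hγd]
  calc pow A a i k + pow A b k j
      ≤ pow A a i k + pow A b k j + (pow (critMat A) x k k' +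
          (pow (critMat A) (a + b) k' l' + pow (critMat A) y l' k)) := le_add_of_nonneg_right h0
    _ = (pow A a i k + pow (critMat A) x k k') + (pow (critMat A) (a + b) k' l' +
          (pow (critMat A) y l' k + pow A b k j)) := by abel
    _ ≤ star (pow A γ) i k' + (pow (critMat A) (a + b) k' l' + star (pow A γ) l' j) := by
        gcongr
    _ ≤ _ := by
        refine le_trans ?_ (le_mul _ _ i k' j)
        rw [if_pos hk'c]
        refine add_le_add le_rfl (le_trans ?_ (le_mul _ _ k' l' j))
        rw [if_pos hl'c]

theorem pow_le_oplus {A : Mat n} (hlam : lam A = 0)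
    (hSC : ∀ i j, critNode A i → critNode A j → reach (critArc A) i j) (t : ℕ) (i j : Fin n) :
    pow A t i j ≤ oplus (csr A t) (pow (bN A) t) i j := by
  by_cases hbot : pow A t i j = ⊥
  · simp [hbot]
  obtain ⟨l, hl, rfl, hw⟩ := exists_trail_of_pow_ne_bot hbot
  rw [← hw]
  by_cases hcrit : ∃ k ∈ i :: l, critNode A k
  · obtain ⟨k, hkl, hk⟩ := hcrit
    obtain ⟨l₁, l₂, rfl, h1, h2⟩ := hl.exists_split hkl
    refine le_max_of_le_left ?_
    rw [h1.trailWeight_append, List.length_append]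
    exact (add_le_add h1.trailWeight_le_pow h2.trailWeight_le_pow).trans
      (le_csr hlam hSC hk _ _ _ _)
  · push Not at hcrit
    have hbN : trailWeight A i l = trailWeight (bN A) i l := by
      clear hw hbot hl
      induction l generalizing i with
      | nil => rfl
      | cons a l ih =>
        rw [trailWeight, trailWeight, ih a fun k hk => hcrit k (List.mem_cons_of_mem _ hk), bN,
          if_neg (not_or.2 ⟨hcrit i (by simp), hcrit a (by simp)⟩)]
    rw [hbN]
    exact le_max_of_le_right hl.trailWeight_le_pow

/-- Critical closed walks through a given critical cycle realize, modulo its length, all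
multiples of the cyclicity. -/
theorem exists_detour {A : Mat n} (hlam : lam A = 0)
    (hSC : ∀ i j, critNode A i → critNode A j → reach (critArc A) i j)
    {Z : List (Fin n)} (hZ : IsCritCycle A Z) {k v : Fin n} (hk : critNode A k) (hv : v ∈ Z)
    {e : ℤ} (he : (cyclicity (critArc A) : ℤ) ∣ e) :
    ∃ p q, Trail (critArc A) k p v ∧ Trail (critArc A) v q k ∧
      (p.length + q.length : ℤ) ≡ e [ZMOD len Z] := by
  have hvc : critNode A v := ⟨Z, hZ, hv⟩
  have hpos := len_pos_of_isCycle hZ.1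
  let P : ℤ → Prop := fun x => ∃ l, Trail (critArc A) v l v ∧ (l.length : ℤ) ≡ x [ZMOD len Z]
  have hP : ∀ {l}, Trail (critArc A) v l v → P l.length := fun {l} hl => ⟨l, hl, rfl⟩
  have hadd : ∀ {x y}, P x → P y → P (x + y) := by
    rintro x y ⟨l, hl, hx⟩ ⟨m, hm, hy⟩
    exact ⟨l ++ m, hl.append hm, by push_cast [List.length_append]; exact hx.add hy⟩
  have hmul : ∀ {x}, P x → ∀ m : ℕ, P (m * x) := by
    intro x hx m
    induction m with
    | zero => exact ⟨[], rfl, by simp⟩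
    | succ m ih => convert hadd ih hx using 1; push_cast; ring
  have hneg : ∀ {x}, P x → P (-x) := by
    intro x hx
    obtain ⟨l, hl, hlx⟩ := hmul hx (len Z - 1)
    refine ⟨l, hl, hlx.trans ?_⟩
    rw [Nat.cast_sub hpos]
    exact (Int.modEq_iff_dvd.2 ⟨-x, by push_cast; ring⟩)
  let H : AddSubgroup ℤ :=
    { carrier := {x | P x}
      zero_mem' := ⟨[], rfl, rfl⟩
      add_mem' := hadd
      neg_mem' := hneg }
  obtain ⟨d, hd⟩ := Int.subgroup_cyclic H
  have hmem : ∀ x, P x ↔ d ∣ x := by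
    intro x
    change x ∈ H ↔ _
    rw [hd, AddSubgroup.mem_closure_singleton]
    exact ⟨fun ⟨m, hm⟩ => ⟨m, by rw [← hm, smul_eq_mul, mul_comm]⟩,
      fun ⟨m, hm⟩ => ⟨m, by rw [hm, smul_eq_mul, mul_comm]⟩⟩
  have hdγ : d.natAbs ∣ cyclicity (critArc A) := by
    rw [dvd_cyclicity_iff hlam hSC hk]
    intro W hW
    obtain ⟨w, l, rfl, -, hl, -⟩ := isCycle_iff.1 hW
    have hw := critNode_of_mem_cycle hW List.mem_cons_self
    obtain ⟨p, hp⟩ := reach_iff.1 (hSC v w hvc hw)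
    obtain ⟨q, hq⟩ := reach_iff.1 (hSC w v hw hvc)
    have h1 := hP ((hp.append hl).append hq)
    have h2 := hneg (hP (hp.append hq))
    have h3 := hadd h1 h2
    rw [hmem] at h3
    rw [len_cons, ← Int.natCast_dvd_natCast]
    refine Int.natAbs_dvd.2 ?_
    convert h3 using 1
    simp only [List.length_append]
    push_cast
    ring
  obtain ⟨p, hp⟩ := reach_iff.1 (hSC k v hk hvc)
  obtain ⟨q, hq⟩ := reach_iff.1 (hSC v k hvc hk)
  have he' : P e := (hmem e).2 ((Int.natAbs_dvd.1 (Int.natCast_dvd_natCast.2 hdγ)).trans he)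
  obtain ⟨l, hl, hle⟩ := hadd he' (hneg (hP (hq.append hp)))
  refine ⟨p, l ++ q, hp, hl.append hq, ?_⟩
  have := hle.add_right ((q ++ p).length : ℤ)
  rw [neg_add_cancel_right] at this
  convert this using 1
  simp only [List.length_append]
  push_cast
  ring

theorem mem_trail_append_iff {R : Fin n → Fin n → Prop} {i k u : Fin n} {l m : List (Fin n)}
    (h : Trail R i l k) : u ∈ i :: (l ++ m) ↔ u ∈ i :: l ∨ u ∈ k :: m := by
  have := h.mem
  simp only [List.mem_cons, List.mem_append] at this ⊢
  constructor
  · tauto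
  · rintro (h | rfl | h) <;> tauto

/-- Among `g` closed walks based at the same node, some can be removed without changing the
residue of the length modulo `g`. -/
theorem exists_shorter_of_blocks {A : Mat n} (hlam : lam A = 0) {g : ℕ} (hg : 0 < g)
    {i v j u : Fin n} {l₀ l₁ : List (Fin n)} {cs : List (List (Fin n))}
    (h₀ : Trail (arc A) i l₀ v) (hcs : ∀ c ∈ cs, Trail (arc A) v c v ∧ c ≠ [])
    (h₁ : Trail (arc A) v l₁ j) (hlen : g ≤ cs.length) (hu : u ∈ i :: l₀ ∨ u ∈ v :: l₁) :
    ∃ l', Trail (arc A) i l' j ∧ u ∈ i :: l' ∧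
      l'.length % g = (l₀ ++ cs.flatten ++ l₁).length % g ∧
      l'.length < (l₀ ++ cs.flatten ++ l₁).length ∧
      trailWeight A i (l₀ ++ cs.flatten ++ l₁) ≤ trailWeight A i l' := by
  obtain ⟨x, y, z, rfl, hy, d, hd⟩ := exists_block_dvd hg cs hlen
  have hx' : Trail (arc A) v x.flatten v := Trail.flatten fun c hc => (hcs c (by simp [hc])).1
  have hy' : Trail (arc A) v y.flatten v := Trail.flatten fun c hc => (hcs c (by simp [hc])).1
  have hz' : Trail (arc A) v z.flatten v := Trail.flatten fun c hc => (hcs c (by simp [hc])).1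
  have hypos : 0 < y.flatten.length := by
    obtain ⟨c, y, rfl⟩ := List.exists_cons_of_ne_nil hy
    have := List.length_pos_of_ne_nil (hcs c (by simp)).2
    simp only [List.flatten_cons, List.length_append]
    omega
  have htrail := h₀.append (hx'.append (hz'.append h₁))
  refine ⟨_, htrail, ?_, ?_, ?_, ?_⟩
  · rw [mem_trail_append_iff h₀, mem_trail_append_iff hx', mem_trail_append_iff hz']
    tauto
  · have : (l₀ ++ (x ++ y ++ z).flatten ++ l₁).length =
        (l₀ ++ (x.flatten ++ (z.flatten ++ l₁))).length + g * d := by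
      rw [← hd]
      simp only [List.flatten_append, List.length_append]
      omega
    rw [this, Nat.add_mul_mod_self_left]
  · simp only [List.flatten_append, List.length_append]
    omega
  · have hle := hy'.trailWeight_nonpos hlam
    have e : l₀ ++ (x ++ y ++ z).flatten ++ l₁ =
        l₀ ++ (x.flatten ++ (y.flatten ++ (z.flatten ++ l₁))) := by
      simp [List.append_assoc]
    rw [e, h₀.trailWeight_append, h₀.trailWeight_append, hx'.trailWeight_append,
      hx'.trailWeight_append, hy'.trailWeight_append]
    gcongr
    exact add_le_of_nonpos_left hle

/-- A long walk through a node of `Z` can be shortened, keeping a node of `Z` and the residue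
of the length modulo `g`, without decreasing its weight. -/
theorem exists_shorter {A : Mat n} (hlam : lam A = 0) {g : ℕ} (hg : 0 < g)
    {Z l : List (Fin n)} {i j : Fin n} (hl : Trail (arc A) i l j)
    (hZ : ∃ u ∈ i :: l, u ∈ Z) (hlen : (g + 1) * n ≤ l.length + 1) :
    ∃ l', Trail (arc A) i l' j ∧ (∃ u ∈ i :: l', u ∈ Z) ∧ l'.length % g = l.length % g ∧
      l'.length < l.length ∧ trailWeight A i l ≤ trailWeight A i l' := by
  obtain ⟨u, hul, huZ⟩ := hZ
  obtain ⟨v, hv⟩ : ∃ v, g + 2 ≤ (i :: l).count v ∨ (v ∈ Z ∧ g + 1 ≤ (i :: l).count v) := by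
    by_contra! hcon
    have hlt : ∑ v : Fin n, (i :: l).count v < ∑ _v : Fin n, (g + 1) :=
      Finset.sum_lt_sum (fun v _ => Nat.lt_succ_iff.1 (hcon v).1)
        ⟨u, Finset.mem_univ u, (hcon u).2 huZ⟩
    have hsum : ∑ v : Fin n, (i :: l).count v = l.length + 1 := by
      simpa using Multiset.sum_count_eq_card (s := Finset.univ)
        (m := ((i :: l : List (Fin n)) : Multiset (Fin n))) (by simp)
    rw [hsum, Finset.sum_const, Finset.card_univ, Fintype.card_fin, smul_eq_mul,
      Nat.mul_comm] at hlt
    omega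
  obtain ⟨k, hk⟩ : ∃ k, (i :: l).count v = k + 1 := ⟨(i :: l).count v - 1, by omega⟩
  obtain ⟨l₀, cs, l₁, hcsl, rfl, h₀, hcs, h₁⟩ := hl.exists_decomp hk
  have hcl : Trail (arc A) v cs.flatten v := Trail.flatten fun c hc => (hcs c hc).1
  by_cases hvZ : v ∈ Z
  · obtain ⟨l', h1, h2, h3⟩ := exists_shorter_of_blocks hlam hg h₀ hcs h₁ (by omega)
      (Or.inl h₀.mem)
    exact ⟨l', h1, ⟨v, h2, hvZ⟩, h3⟩
  have hk' : g + 1 ≤ k := by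
    rcases hv with hv | hv
    · omega
    · exact absurd hv.1 hvZ
  by_cases hends : u ∈ i :: l₀ ∨ u ∈ v :: l₁
  · obtain ⟨l', h1, h2, h3⟩ := exists_shorter_of_blocks hlam hg h₀ hcs h₁ (by omega) hends
    exact ⟨l', h1, ⟨u, h2, huZ⟩, h3⟩
  obtain ⟨c, hc, huc⟩ : ∃ c ∈ cs, u ∈ c := by
    rw [← List.mem_flatten]
    simp only [List.mem_cons, List.mem_append] at hul hends
    tauto
  obtain ⟨x, y, rfl⟩ := List.append_of_mem hc
  have hcs' : ∀ d ∈ x ++ y, Trail (arc A) v d v ∧ d ≠ [] := fun d hd =>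
    hcs d (by simp only [List.mem_append, List.mem_cons] at hd ⊢; tauto)
  have hx' : Trail (arc A) v x.flatten v := Trail.flatten fun d hd => (hcs' d (by simp [hd])).1
  have hc' := (hcs c hc).1
  obtain ⟨l', h1, h2, h3, h4, h5⟩ := exists_shorter_of_blocks hlam hg (h₀.append hc') hcs' h₁
    (u := u) (by simp only [List.length_append, List.length_cons] at hcsl ⊢; omega)
    (Or.inl ((mem_trail_append_iff h₀).2 (Or.inr (List.mem_cons_of_mem _ huc))))
  have hlen' : (l₀ ++ c ++ (x ++ y).flatten ++ l₁).length =
      (l₀ ++ (x ++ c :: y).flatten ++ l₁).length := by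
    simp only [List.flatten_append, List.flatten_cons, List.length_append]
    omega
  rw [hlen'] at h3 h4
  refine ⟨l', h1, ⟨u, h2, huZ⟩, h3, h4, le_trans (le_of_eq ?_) h5⟩
  simp only [List.flatten_append, List.flatten_cons, List.append_assoc]
  rw [h₀.trailWeight_append, h₀.trailWeight_append, hx'.trailWeight_append,
    hc'.trailWeight_append, hc'.trailWeight_append, hx'.trailWeight_append]
  abel

theorem cons_mem_throughSet_iff {A : Mat n} {Z : List (Fin n)} {i j k : Fin n} {γ m : ℕ}
    {l : List (Fin n)} : k :: l ∈ ThroughSet A Z i j γ m ↔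
      k = i ∧ Trail (arc A) i l j ∧ (∃ v ∈ k :: l, v ∈ Z) ∧ l.length % γ = m % γ := by
  change IsWalkFrom (arc A) (k :: l) i j ∧ _ ∧ len (k :: l) % γ = m % γ ↔ _
  rw [isWalkFrom_cons_iff, len_cons]
  tauto

theorem exists_cons_of_mem_throughSet {A : Mat n} {Z : List (Fin n)} {i j : Fin n} {γ m : ℕ}
    {W : List (Fin n)} (hW : W ∈ ThroughSet A Z i j γ m) : ∃ l, W = i :: l := by
  obtain ⟨l, rfl, -⟩ := isWalkFrom_iff.1 hW.1
  exact ⟨l, rfl⟩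

theorem exists_shorter_mem_throughSet {A : Mat n} (hlam : lam A = 0) {g m : ℕ} (hg : 0 < g)
    {Z W : List (Fin n)} {i j : Fin n} (hW : W ∈ ThroughSet A Z i j g m)
    (hlen : (g + 1) * n ≤ len W + 1) :
    ∃ V ∈ ThroughSet A Z i j g m, len V < len W ∧ weight A W ≤ weight A V := by
  obtain ⟨l, rfl⟩ := exists_cons_of_mem_throughSet hW
  obtain ⟨-, hl, hZ, hm⟩ := cons_mem_throughSet_iff.1 hW
  rw [len_cons] at hlen
  obtain ⟨l', h1, h2, h3, h4, h5⟩ := exists_shorter hlam hg hl hZ hlen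
  refine ⟨i :: l', cons_mem_throughSet_iff.2 ⟨rfl, h1, h2, h3.trans hm⟩, ?_, ?_⟩
  · rwa [len_cons, len_cons]
  · rwa [weight_cons, weight_cons]

theorem exists_short_mem_throughSet {A : Mat n} (hlam : lam A = 0) {g m : ℕ} (hg : 0 < g)
    {Z W : List (Fin n)} {i j : Fin n} (hW : W ∈ ThroughSet A Z i j g m) :
    ∃ V ∈ ThroughSet A Z i j g m, len V < (g + 1) * n ∧ weight A W ≤ weight A V := by
  induction hN : len W using Nat.strong_induction_on generalizing W with
  | _ N ih =>
    by_cases hlen : (g + 1) * n ≤ len W + 1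
    · obtain ⟨V, hV, hlt, hle⟩ := exists_shorter_mem_throughSet hlam hg hW hlen
      obtain ⟨U, hU, hU', hle'⟩ := ih (len V) (hN ▸ hlt) hV rfl
      exact ⟨U, hU, hU', hle.trans hle'⟩
    · exact ⟨W, hW, by omega, le_rfl⟩

theorem exists_twiceOpt {A : Mat n} (hlam : lam A = 0) {g m : ℕ} (hg : 0 < g)
    {Z : List (Fin n)} {i j : Fin n} (hne : (ThroughSet A Z i j g m).Nonempty) :
    ∃ W, TwiceOpt A Z i j g m W := by
  obtain ⟨W₀, hW₀⟩ := hne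
  obtain ⟨V₀, hV₀, hV₀', -⟩ := exists_short_mem_throughSet hlam hg hW₀
  have hfin : {V ∈ ThroughSet A Z i j g m | len V < (g + 1) * n}.Finite := by
    refine (List.finite_length_le (Fin n) ((g + 1) * n)).subset fun V hV => ?_
    have : V.length - 1 < (g + 1) * n := hV.2
    change V.length ≤ _
    omega
  obtain ⟨U, hU, hUmax⟩ := Set.exists_max_image _ (weight A) hfin ⟨V₀, hV₀, hV₀'⟩
  have hmax : ∀ V ∈ ThroughSet A Z i j g m, weight A V ≤ weight A U := by
    intro V hV
    obtain ⟨V', hV', hlen, hle⟩ := exists_short_mem_throughSet hlam hg hV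
    exact hle.trans (hUmax V' ⟨hV', hlen⟩)
  obtain ⟨W, ⟨hW, hWU⟩, hmin⟩ := WellFounded.has_min (measure (len (n := n))).wf
    {V ∈ ThroughSet A Z i j g m | weight A V = weight A U} ⟨U, hU.1, rfl⟩
  exact ⟨W, hW, fun V hV => hWU ▸ hmax V hV,
    fun V hV hVW => not_lt.1 (hmin V ⟨hV, hVW.trans hWU⟩)⟩

/-- The CSR term is dominated by the walks through a critical cycle whose length has the
right residue modulo the length of the cycle. -/
theorem exists_mem_throughSet_csr_le {A : Mat n} (hlam : lam A = 0)
    (hSC : ∀ i j, critNode A i → critNode A j → reach (critArc A) i j)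
    {Z : List (Fin n)} (hZ : IsCritCycle A Z) {t : ℕ} {i j : Fin n} (h : csr A t i j ≠ ⊥) :
    ∃ W ∈ ThroughSet A Z i j (len Z) t, csr A t i j ≤ weight A W := by
  obtain ⟨k, a, b, m, hk, ha, hb, hlen, hw⟩ := exists_trail_of_csr_ne_bot hlam h
  obtain ⟨v, l, rfl, -⟩ := isCycle_iff.1 hZ.1
  have hvZ : v ∈ v :: l := List.mem_cons_self
  obtain ⟨p, q, hp, hq, hpq⟩ := exists_detour hlam hSC hZ hk hvZ
    (e := -(cyclicity (critArc A) * m : ℤ)) (dvd_neg.2 (dvd_mul_right _ _))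
  have hpq0 := (hp.append hq).trailWeight_nonneg hlam
  rw [hp.trailWeight_append] at hpq0
  have hp' := hp.of_critArc hlam
  have hq' := hq.of_critArc hlam
  refine ⟨i :: (a ++ (p ++ (q ++ b))), cons_mem_throughSet_iff.2
    ⟨rfl, ha.append (hp'.append (hq'.append hb)), ⟨v, ?_, hvZ⟩, ?_⟩, ?_⟩
  · rw [mem_trail_append_iff ha, mem_trail_append_iff hp']
    exact Or.inr (Or.inl hp'.mem)
  · change _ ≡ _ [MOD _]
    rw [← Int.natCast_modEq_iff]
    have hlen' : (a.length + b.length : ℤ) = t + cyclicity (critArc A) * m := by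
      exact_mod_cast hlen
    have := hpq.add_left (a.length + b.length : ℤ)
    convert this using 1
    · simp only [List.length_append]
      push_cast
      ring
    · rw [hlen']
      ring
  · rw [weight_cons, ha.trailWeight_append, hp'.trailWeight_append, hq'.trailWeight_append]
    calc csr A t i j ≤ trailWeight A i a + trailWeight A k b := hw
      _ ≤ trailWeight A i a + trailWeight A k b + (trailWeight A k p + trailWeight A v q) :=
        le_add_of_nonneg_right hpq0
      _ = _ := by abel

/-- Walks through a critical cycle can be prolonged by copies of this cycle. -/
theorem weight_le_pow_of_mem_throughSet {A : Mat n} (hlam : lam A = 0) {Z W : List (Fin n)}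
    (hZ : IsCritCycle A Z) {t : ℕ} {i j : Fin n} (hW : W ∈ ThroughSet A Z i j (len Z) t)
    (hle : len W ≤ t) : weight A W ≤ pow A t i j := by
  obtain ⟨l, rfl⟩ := exists_cons_of_mem_throughSet hW
  obtain ⟨-, hl, ⟨v, hv, hvZ⟩, hm⟩ := cons_mem_throughSet_iff.1 hW
  obtain ⟨l₁, l₂, rfl, h1, h2⟩ := hl.exists_split hv
  obtain ⟨c, hc, hclen, hcw⟩ := hZ.exists_closed hlam hvZ
  have hc0 : 0 ≤ pow A (len Z) v v := by
    rw [← hcw, ← hclen]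
    exact hc.trailWeight_le_pow
  rw [len_cons] at hle
  obtain ⟨d, hd⟩ := (Nat.modEq_iff_dvd' hle).1 hm
  have ht : t = l₁.length + (len Z * d + l₂.length) := by
    rw [List.length_append] at hle hd
    omega
  rw [weight_cons, h1.trailWeight_append, ht]
  calc trailWeight A i l₁ + trailWeight A v l₂
      ≤ pow A l₁.length i v + pow A l₂.length v j :=
        add_le_add h1.trailWeight_le_pow h2.trailWeight_le_pow
    _ ≤ pow A l₁.length i v + (pow A (len Z * d) v v + pow A l₂.length v j) := by
        gcongr
        exact le_add_of_nonneg_left (zero_le_pow_mul hc0 d)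
    _ ≤ pow A l₁.length i v + pow A (len Z * d + l₂.length) v j := by
        gcongr
        exact pow_add_le _ _ _ _ _ _
    _ ≤ _ := pow_add_le _ _ _ _ _ _

/-- Proposition 4.7: if `λ(A) = 0`, `C(A)` is strongly connected with a unique critical
cycle `Z₀` of length `g = g(C(A))` up to choice of its first node, and `T₁(A) = DM(g,n)`,
then there is a pair `(i,j)` with `(A^{DM(g,n)-1})_{ij} < (CS^{DM(g,n)-1}R)_{ij}`, and for
any such `(i,j)` there is an interesting walk from `i` to `j`. -/
theorem exists_interesting_walk {n : ℕ} (A : Mat n) (g : ℕ)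
    (hgdef : g = maxGirth (critArc A)) (hlam : lam A = 0)
    (Z0 : List (Fin n)) (hZ0 : IsCritCycle A Z0) (hZ0len : len Z0 = g)
    (hSC : ∀ i j, critNode A i → critNode A j → reach (critArc A) i j)
    (huniq : ∀ Z, IsCritCycle A Z → len Z = g → Z.dropLast ~r Z0.dropLast)
    (hT : T1 A = DM g n) :
    (∃ i j, pow A (DM g n - 1) i j < csr A (DM g n - 1) i j) ∧
    (∀ i j, pow A (DM g n - 1) i j < csr A (DM g n - 1) i j →
      ∃ W, Interesting A g Z0 i j W) := by
  have hg : 0 < g := hZ0len ▸ len_pos_of_isCycle hZ0.1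
  obtain ⟨z, -⟩ := isCycle_iff.1 hZ0.1
  have hn : 0 < n := z.pos
  have hDM : 0 < DM g n := Nat.add_pos_right _ hn
  refine ⟨?_, fun i j hij => ?_⟩
  · by_contra! hcon
    have hne : {T | ∀ t, T ≤ t → pow A t = oplus (csr A t) (pow (bN A) t)}.Nonempty :=
      Nat.nonempty_of_pos_sInf (hT ▸ hDM : 0 < T1 A)
    have hmem : ∀ t, T1 A ≤ t → pow A t = oplus (csr A t) (pow (bN A) t) := Nat.sInf_mem hne
    have hlt : DM g n - 1 < T1 A := by omega
    refine Nat.notMem_of_lt_sInf hlt fun t ht => ?_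
    rcases Nat.lt_or_ge t (T1 A) with htT | htT
    · obtain rfl : t = DM g n - 1 := by omega
      ext i j : 2
      refine le_antisymm (pow_le_oplus hlam hSC _ i j) (max_le (hcon i j) ?_)
      refine pow_mono (fun i j => ?_) _ i j
      unfold bN
      split_ifs <;> simp
    · exact hmem t htT
  · obtain ⟨V, hV, hVle⟩ := exists_mem_throughSet_csr_le hlam hSC hZ0 hij.ne_bot
    rw [hZ0len] at hV
    obtain ⟨W, hW⟩ := exists_twiceOpt hlam hg ⟨V, hV⟩
    refine ⟨W, hW, ?_⟩
    have hlong : DM g n - 1 < len W := by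
      by_contra! hle
      have := weight_le_pow_of_mem_throughSet hlam hZ0 (by rw [hZ0len]; exact hW.1) hle
      exact (hij.trans_le (hVle.trans (hW.2.1 V hV))).not_ge this
    have hshort : len W + 1 < (g + 1) * n := by
      by_contra! hlen
      obtain ⟨U, hU, hlt, hle⟩ := exists_shorter_mem_throughSet hlam hg hW.1 hlen
      exact hlt.not_ge (hW.2.2 U hU (le_antisymm (hW.2.1 U hU) hle))
    obtain ⟨d, hd⟩ := (Nat.modEq_iff_dvd' hlong.le).1 hW.1.2.2.symm
    have hbound : (g + 1) * n ≤ DM g n - 1 + 2 * g + 1 := by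
      unfold DM
      rcases n with _ | _ | n
      · omega
      · omega
      · rw [show n + 1 + 1 - 2 = n by omega]
        have : (g + 1) * (n + 1 + 1) = g * n + 2 * g + (n + 1 + 1) := by ring
        omega
    have hd1 : d = 1 := by
      have h0 : d ≠ 0 := by
        rintro rfl
        omega
      have h2 : d < 2 := by
        by_contra! h2
        have := Nat.mul_le_mul_left g h2
        omega
      omega
    rw [hd1] at hd
    omega

end MaxPlus
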